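/- arXiv:2104.04341 — 5 statements merged into one kernel-verified Lean document; each statement's English description precedes it below -/
import Mathlib

section
/- Let 𝒜 = (a_i)_{i≥1} be a sequence of positive integers and let k ≥ 1 and m ≥ 2 be integers. Then the sequence (p_𝒜(n,k) mod m)_{n≥0} is purely periodic, and T = m^{k−1}·lcm(a_1,…,a_k) is a period: p_𝒜(n + T, k) ≡ p_𝒜(n,k) (mod m) for all n ≥ 0. -/
/-- `pA a k n` is the number of multi-color partitions of `n` into parts
`a 1, …, a k`. -/
noncomputable def pA (a : ℕ → ℕ) (k : ℕ) (n : ℤ) : ℕ :=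
  Nat.card {x : Fin k → ℕ // ∑ i : Fin k, (x i : ℤ) * (a (i.val + 1) : ℤ) = n}

/-- In characteristic dividing `m`, the element `y ^ m ^ j - 1` is divisible by
`(y - 1) ^ (j + 1)`. -/
theorem sub_one_pow_dvd_pow_pow_sub_one {R : Type*} [CommRing R] (m : ℕ) (hm : (m : R) = 0)
    (y : R) (j : ℕ) : (y - 1) ^ (j + 1) ∣ y ^ m ^ j - 1 := by
  induction j with
  | zero => simp
  | succ j ih =>
    set z := y ^ m ^ j with hz
    have h1 : y - 1 ∣ ∑ i ∈ Finset.range m, z ^ i := by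
      have h2 : ∑ i ∈ Finset.range m, z ^ i = ∑ i ∈ Finset.range m, (z ^ i - 1) := by
        simp [Finset.sum_sub_distrib, hm]
      rw [h2]
      refine Finset.dvd_sum fun i _ => ?_
      rw [hz, ← pow_mul]
      exact sub_one_dvd_pow_sub_one y _
    rw [pow_succ m j, pow_mul, ← hz, ← geom_sum_mul, pow_succ']
    exact mul_dvd_mul h1 ih

/-- The geometric series `∑ j, X ^ (d * j)`. -/
noncomputable def multiplesSeries (R : Type*) [CommRing R] (d : ℕ) : PowerSeries R :=
  PowerSeries.mk fun n => if d ∣ n then 1 else 0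

theorem multiplesSeries_mul_X_pow_sub_one (R : Type*) [CommRing R] {d : ℕ} (hd : 0 < d) :
    multiplesSeries R d * (PowerSeries.X ^ d - 1) = -1 := by
  ext n
  rw [mul_sub, mul_one, map_sub, PowerSeries.coeff_mul_X_pow', map_neg, PowerSeries.coeff_one]
  simp only [multiplesSeries, PowerSeries.coeff_mk]
  by_cases h : d ≤ n
  · have hn : n ≠ 0 := by omega
    rw [if_pos h, if_neg hn, neg_zero, sub_eq_zero]
    simp only [Nat.dvd_sub_iff_left h dvd_rfl]
  · rcases Nat.eq_zero_or_pos n with rfl | hn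
    · simp [h]
    · simp [h, hn.ne', Nat.not_dvd_of_pos_of_lt hn (not_le.mp h)]

/-- The generating function of `pA a k` is the product of the series of multiples of the parts. -/
theorem coeff_prod_multiplesSeries (R : Type*) [CommRing R] (a : ℕ → ℕ) (ha : ∀ i, 0 < a i)
    (k n : ℕ) :
    PowerSeries.coeff n (∏ i : Fin k, multiplesSeries R (a (i.val + 1))) = (pA a k n : R) := by
  classical
  rw [PowerSeries.coeff_prod]
  simp only [multiplesSeries, PowerSeries.coeff_mk, Finset.prod_ite_zero, Finset.prod_const_one]
  rw [Finset.sum_boole]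
  congr 1
  rw [pA, ← Nat.subtype_card _ fun _ => Finset.mem_filter]
  symm
  refine Nat.card_congr
    { toFun := fun x => ⟨Finsupp.equivFunOnFinite.symm fun i => x.1 i * a (i.val + 1), ?_, ?_⟩
      invFun := fun l => ⟨fun i => l.1 i / a (i.val + 1), ?_⟩
      left_inv := ?_
      right_inv := ?_ }
  · have := x.2
    rw [Finset.mem_finsuppAntidiag]
    refine ⟨?_, Finset.subset_univ _⟩
    simp only [Finsupp.equivFunOnFinite_symm_apply_apply]
    exact_mod_cast this
  · intro i _
    simp
  · obtain ⟨l, hl, hdvd⟩ := l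
    rw [Finset.mem_finsuppAntidiag] at hl
    have h : ∀ i : Fin k, l i / a (i.val + 1) * a (i.val + 1) = l i :=
      fun i => Nat.div_mul_cancel (hdvd i (Finset.mem_univ i))
    exact_mod_cast (Finset.sum_congr rfl fun i _ => h i).trans hl.1
  · intro x
    ext i
    simp [Nat.mul_div_cancel _ (ha _)]
  · rintro ⟨l, hl, hdvd⟩
    ext i
    simpa using Nat.div_mul_cancel (hdvd i (Finset.mem_univ i))

theorem stmt_1 (a : ℕ → ℕ) (ha : ∀ i, 0 < a i) (k m : ℕ) (hk : 1 ≤ k) (hm : 2 ≤ m)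
    (T : ℕ) (hT : T = m ^ (k - 1) * (Finset.Icc 1 k).lcm a) :
    ∀ n : ℕ, pA a k ((n : ℤ) + (T : ℤ)) ≡ pA a k (n : ℤ) [MOD m] := by
  intro n
  have : Fact (1 < m) := ⟨hm⟩
  set L := (Finset.Icc 1 k).lcm a with hL
  have hL0 : L ≠ 0 := by
    rw [hL, Ne, Finset.lcm_eq_zero_iff]
    rintro ⟨i, -, hi⟩
    exact (ha i).ne' hi
  have hT0 : T ≠ 0 := by rw [hT]; positivity
  set D : Polynomial (ZMod m) := ∏ i : Fin k, (Polynomial.X ^ a (i.val + 1) - 1) with hD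
  have hmon : ∀ i : Fin k, (Polynomial.X ^ a (i.val + 1) - 1 : Polynomial (ZMod m)).Monic :=
    fun i => Polynomial.monic_X_pow_sub_C 1 (ha _).ne'
  have hDmon : D.Monic := Polynomial.monic_prod_of_monic _ _ fun i _ => hmon i
  have hDdeg : 0 < D.natDegree := by
    rw [hD, Polynomial.natDegree_prod_of_monic _ _ fun i _ => hmon i]
    refine Finset.sum_pos (fun i _ => ?_) ⟨⟨0, hk⟩, Finset.mem_univ _⟩
    have := Polynomial.natDegree_X_pow_sub_C (R := ZMod m) (n := a (i.val + 1)) (r := 1)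
    rw [map_one] at this
    rw [this]
    exact ha _
  have hdvd : D ∣ Polynomial.X ^ T - 1 := by
    have h1 : D ∣ (Polynomial.X ^ L - 1) ^ (k - 1 + 1) := by
      rw [Nat.sub_add_cancel hk]
      have : ∏ _i : Fin k, (Polynomial.X ^ L - 1 : Polynomial (ZMod m)) =
        (Polynomial.X ^ L - 1) ^ k := by simp
      rw [← this]
      refine Finset.prod_dvd_prod_of_dvd _ _ fun i _ => ?_
      obtain ⟨c, hc⟩ : a (i.val + 1) ∣ L :=
        Finset.dvd_lcm (Finset.mem_Icc.mpr ⟨by omega, by omega⟩)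
      rw [hc, pow_mul]
      exact sub_one_dvd_pow_sub_one _ c
    refine h1.trans ?_
    rw [hT, mul_comm, pow_mul]
    refine sub_one_pow_dvd_pow_pow_sub_one m ?_ _ _
    exact CharP.cast_eq_zero _ m
  obtain ⟨Q, hQ⟩ := hdvd
  have hQ0 : Q ≠ 0 := by
    rintro rfl
    rw [mul_zero] at hQ
    exact (Polynomial.monic_X_pow_sub_C (1 : ZMod m) hT0).ne_zero (by simpa using hQ)
  have hQdeg : Q.natDegree < T := by
    have h1 := hDmon.natDegree_mul' hQ0
    have h2 := Polynomial.natDegree_X_pow_sub_C (R := ZMod m) (n := T) (r := 1)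
    rw [map_one, hQ] at h2
    omega
  set F : PowerSeries (ZMod m) := ∏ i : Fin k, multiplesSeries (ZMod m) (a (i.val + 1)) with hF
  have hFD : F * (D : PowerSeries (ZMod m)) = (-1) ^ k := by
    rw [hD, ← Polynomial.coeToPowerSeries.ringHom_apply, map_prod, hF, ← Finset.prod_mul_distrib]
    simp [multiplesSeries_mul_X_pow_sub_one _ (ha _)]
  have hFT : F * (PowerSeries.X ^ T - 1) = (-1) ^ k * (Q : PowerSeries (ZMod m)) := by
    rw [← hFD, mul_assoc, ← Polynomial.coe_mul, ← hQ]
    simp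
  have hcoeff := congrArg (PowerSeries.coeff (n + T)) hFT
  have hQc : Q.coeff (n + T) = 0 := Polynomial.coeff_eq_zero_of_natDegree_lt (by omega)
  have hzero : PowerSeries.coeff (n + T) ((-1) ^ k * (Q : PowerSeries (ZMod m))) = 0 := by
    rcases neg_one_pow_eq_or (PowerSeries (ZMod m)) k with h | h <;> simp [h, hQc]
  rw [hzero, mul_sub, mul_one, map_sub, PowerSeries.coeff_mul_X_pow, hF,
    coeff_prod_multiplesSeries _ a ha, coeff_prod_multiplesSeries _ a ha, sub_eq_zero] at hcoeff
  rw [← ZMod.natCast_eq_natCast_iff, hcoeff]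
  push_cast
  rfl
end

section
/- Let 𝒜 = (a_i)_{i≥1} be a sequence of positive integers and let k ≥ 2 be an integer. Then the natural densities of the sets {n ∈ ℕ : p_𝒜(n,k) ≡ 1 (mod 2) and p_𝒜(n,k−1) ≡ 1 (mod 2)} and {n ∈ ℕ : p_𝒜(n,k) ≡ 0 (mod 2) and p_𝒜(n,k−1) ≡ 1 (mod 2)} both exist and are equal, i.e. lim_{N→∞} #{n ≤ N : p_𝒜(n,k) ≡ p_𝒜(n,k−1) ≡ 1 (mod 2)}/N = lim_{N→∞} #{n ≤ N : p_𝒜(n,k) ≢ p_𝒜(n,k−1) ≡ 1 (mod 2)}/N. -/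
open Filter

lemma finite_pA (a : ℕ → ℕ) (ha : ∀ i, 0 < a i) (k : ℕ) (n : ℤ) :
    Finite {x : Fin k → ℕ // ∑ i : Fin k, (x i : ℤ) * (a (i.val + 1) : ℤ) = n} := by
  refine Set.Finite.to_subtype ((Set.finite_Iic (fun _ : Fin k => n.toNat)).subset ?_)
  intro x hx i
  have h1 : (x i : ℤ) * (a (i.val + 1) : ℤ) ≤ n := by
    rw [← show ∑ i : Fin k, (x i : ℤ) * (a (i.val + 1) : ℤ) = n from hx]
    exact Finset.single_le_sum (f := fun i : Fin k => (x i : ℤ) * (a (i.val + 1) : ℤ))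
      (fun j _ => by positivity) (Finset.mem_univ i)
  have h2 : (1 : ℤ) ≤ a (i.val + 1) := by exact_mod_cast ha _
  have h3 : (x i : ℤ) ≤ n := by nlinarith [Int.natCast_nonneg (x i)]
  change x i ≤ n.toNat
  omega

/-- Splitting the partitions of `n` according to whether the last part is used. -/
def partitionEquiv (a : ℕ → ℕ) (k : ℕ) (n : ℤ) :
    {x : Fin (k + 1) → ℕ // ∑ i : Fin (k + 1), (x i : ℤ) * (a (i.val + 1) : ℤ) = n} ≃
      {x : Fin (k + 1) → ℕ //
        ∑ i : Fin (k + 1), (x i : ℤ) * (a (i.val + 1) : ℤ) = n - a (k + 1)} ⊕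
      {x : Fin k → ℕ // ∑ i : Fin k, (x i : ℤ) * (a (i.val + 1) : ℤ) = n} where
  toFun x :=
    if h : x.1 (Fin.last k) = 0 then
      Sum.inr ⟨fun i => x.1 i.castSucc, by
        have hx := x.2
        rw [Fin.sum_univ_castSucc, h] at hx
        simpa using hx⟩
    else
      Sum.inl ⟨Fin.snoc (α := fun _ => ℕ) (fun i => x.1 i.castSucc) (x.1 (Fin.last k) - 1), by
        have hx := x.2
        rw [Fin.sum_univ_castSucc] at hx ⊢
        simp only [Fin.snoc_castSucc, Fin.snoc_last, Fin.val_castSucc, Fin.val_last] at hx ⊢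
        rw [Nat.cast_sub (Nat.one_le_iff_ne_zero.mpr h)]
        push_cast
        linarith⟩
  invFun y := y.elim
    (fun x => ⟨Fin.snoc (α := fun _ => ℕ) (fun i => x.1 i.castSucc) (x.1 (Fin.last k) + 1), by
      have hx := x.2
      rw [Fin.sum_univ_castSucc] at hx ⊢
      simp only [Fin.snoc_castSucc, Fin.snoc_last, Fin.val_castSucc, Fin.val_last] at hx ⊢
      push_cast
      linarith⟩)
    (fun x => ⟨Fin.snoc (α := fun _ => ℕ) x.1 0, by
      rw [Fin.sum_univ_castSucc]
      simpa using x.2⟩)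
  left_inv x := by
    by_cases h : x.1 (Fin.last k) = 0
    · simp only [h, dite_true, Sum.elim_inr]
      ext i
      refine Fin.lastCases ?_ (fun j => ?_) i <;> simp [h]
    · simp only [h, dite_false, Sum.elim_inl]
      ext i
      refine Fin.lastCases ?_ (fun j => ?_) i
      · simp; omega
      · simp
  right_inv y := by
    rcases y with x | x
    · simp only [Sum.elim_inl, Fin.snoc_last, Nat.add_eq_zero_iff, one_ne_zero, and_false,
        dite_false]
      congr 1
      ext i
      refine Fin.lastCases ?_ (fun j => ?_) i <;> simp
    · simp

lemma pA_succ (a : ℕ → ℕ) (ha : ∀ i, 0 < a i) (k : ℕ) (n : ℤ) :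
    pA a (k + 1) n = pA a (k + 1) (n - a (k + 1)) + pA a k n := by
  have := finite_pA a ha (k + 1) (n - a (k + 1))
  have := finite_pA a ha k n
  exact (Nat.card_congr (partitionEquiv a k n)).trans Nat.card_sum

lemma pA_zero_of_ne (a : ℕ → ℕ) (n : ℤ) (hn : n ≠ 0) : pA a 0 n = 0 := by
  have : IsEmpty {x : Fin 0 → ℕ // ∑ i : Fin 0, (x i : ℤ) * (a (i.val + 1) : ℤ) = n} :=
    ⟨fun x => hn (by simpa using x.2.symm)⟩
  exact Nat.card_of_isEmpty

lemma pA_add_mul (a : ℕ → ℕ) (ha : ∀ i, 0 < a i) (k : ℕ) (n : ℤ) (m : ℕ) :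
    pA a (k + 1) (n + m * a (k + 1)) =
      pA a (k + 1) n + ∑ j ∈ Finset.range m, pA a k (n + (j + 1) * a (k + 1)) := by
  induction m with
  | zero => simp
  | succ m ih =>
    rw [pA_succ a ha, Finset.sum_range_succ, ← add_assoc, ← ih]
    congr 2
    push_cast
    ring

lemma mod_two_add_mul_of_periodic (f : ℤ → ℕ) (T : ℕ)
    (hf : ∀ n : ℤ, 1 ≤ n → f (n + T) % 2 = f n % 2) (m : ℕ) (n : ℤ) (hn : 1 ≤ n) :
    f (n + m * T) % 2 = f n % 2 := by
  induction m with
  | zero => simp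
  | succ m ih =>
    rw [← ih, ← hf (n + m * T) (by nlinarith [Int.natCast_nonneg m, Int.natCast_nonneg T])]
    congr 2
    push_cast
    ring

lemma pA_mod_two_periodic (a : ℕ → ℕ) (ha : ∀ i, 0 < a i) (k : ℕ) :
    ∃ T : ℕ, 0 < T ∧ ∀ n : ℤ, 1 ≤ n → pA a k (n + T) % 2 = pA a k n % 2 := by
  induction k with
  | zero =>
    refine ⟨1, one_pos, fun n hn => ?_⟩
    rw [pA_zero_of_ne a n (by omega), pA_zero_of_ne a _ (by push_cast; omega)]
  | succ k ih =>
    obtain ⟨T, hT, h⟩ := ih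
    refine ⟨2 * T * a (k + 1), by have := ha (k + 1); positivity, fun n hn => ?_⟩
    have hsum : (∑ j ∈ Finset.range T, pA a k (n + T * a (k + 1) + (j + 1) * a (k + 1))) % 2 =
        (∑ j ∈ Finset.range T, pA a k (n + (j + 1) * a (k + 1))) % 2 := by
      rw [Finset.sum_nat_mod, Finset.sum_nat_mod (Finset.range T) 2
        (fun j => pA a k (n + (j + 1) * a (k + 1)))]
      congr 1
      refine Finset.sum_congr rfl fun j _ => ?_
      rw [← mod_two_add_mul_of_periodic _ T h (a (k + 1)) (n + (j + 1) * a (k + 1)) (by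
        have : (0 : ℤ) ≤ (j + 1) * a (k + 1) := by positivity
        omega)]
      congr 2
      ring
    have h1 := pA_add_mul a ha k n T
    have h2 := pA_add_mul a ha k (n + T * a (k + 1)) T
    have h3 : n + ((2 * T * a (k + 1) : ℕ) : ℤ) = n + T * a (k + 1) + T * a (k + 1) := by
      push_cast
      ring
    rw [h3]
    omega

lemma tendsto_div_atTop_of_abs_sub_le (u : ℕ → ℝ) (d B : ℝ)
    (h : ∀ N : ℕ, |u N - d * N| ≤ B) :
    Tendsto (fun N : ℕ => u N / N) atTop (nhds d) := by
  have h0 : Tendsto (fun N : ℕ => (u N - d * N) / N) atTop (nhds 0) := by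
    refine squeeze_zero_norm (fun N => ?_) (tendsto_const_div_atTop_nhds_zero_nat B)
    rw [norm_div, Real.norm_eq_abs, Real.norm_natCast]
    gcongr
    exact h N
  have h1 := h0.add_const d
  rw [zero_add] at h1
  refine h1.congr' ?_
  filter_upwards [eventually_gt_atTop 0] with N hN
  have : (N : ℝ) ≠ 0 := by positivity
  field_simp
  ring

lemma exists_bound_of_periodic (h : ℕ → ℝ) (T : ℕ) (hT : 0 < T) (hp : ∀ n, h (n + T) = h n) :
    ∃ B, ∀ n, |h n| ≤ B := by
  refine ⟨∑ i ∈ Finset.range T, |h i|, fun n => ?_⟩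
  rw [← Function.Periodic.map_mod_nat (f := h) (a := T) hp n]
  exact Finset.single_le_sum (f := fun i => |h i|) (fun _ _ => abs_nonneg _)
    (Finset.mem_range.mpr (Nat.mod_lt _ hT))

lemma card_filter_range_succ (P : ℕ → Prop) [DecidablePred P] (N : ℕ) :
    ((Finset.range (N + 1)).filter P).card =
      ((Finset.range N).filter P).card + if P N then 1 else 0 := by
  rw [Finset.range_add_one, Finset.filter_insert]
  split_ifs <;> simp

/-- A set of naturals that is periodic from `1` on has a natural density, with bounded error. -/
lemma exists_density_of_periodic (P : ℕ → Prop) [DecidablePred P] (T : ℕ) (hT : 0 < T)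
    (hP : ∀ n, 1 ≤ n → (P (n + T) ↔ P n)) :
    ∃ d B : ℝ, ∀ N : ℕ, |(((Finset.range (N + 1)).filter P).card : ℝ) - d * N| ≤ B := by
  set u : ℕ → ℝ := fun N => (((Finset.range (N + 1)).filter P).card : ℝ) with hu
  have hsucc : ∀ N, u (N + 1) = u N + if P (N + 1) then 1 else 0 := by
    intro N
    simp only [hu]
    rw [card_filter_range_succ P (N + 1)]
    push_cast
    rfl
  have hstep : ∀ N, u (N + T) = u N + (u T - u 0) := by
    intro N
    induction N with
    | zero => simp
    | succ N ih =>
      rw [show N + 1 + T = N + T + 1 by ring, hsucc, hsucc, ih,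
        show N + T + 1 = N + 1 + T by ring]
      simp only [hP (N + 1) (by omega)]
      ring
  refine ⟨(u T - u 0) / T, exists_bound_of_periodic _ T hT fun N => ?_⟩
  change u (N + T) - _ = u N - _
  rw [hstep]
  have : (T : ℝ) ≠ 0 := by positivity
  push_cast
  field_simp
  ring

lemma abs_sum_sub_shift_le (F : ℤ → ℝ) (hF : ∀ n, |F n| ≤ 1) (b N : ℕ) :
    |∑ n ∈ Finset.range N, (F n - F (n - b))| ≤ 2 * b := by
  have key : ∑ n ∈ Finset.range N, (F n - F (n - b)) =
      ∑ j ∈ Finset.range b, (F (N - 1 - j) - F (-1 - j)) := by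
    induction N with
    | zero => simp
    | succ N ih =>
      rw [Finset.sum_range_succ, ih, Finset.sum_sub_distrib, Finset.sum_sub_distrib]
      have h1 := Finset.sum_range_succ (fun j : ℕ => F ((N : ℤ) - j)) b
      rw [Finset.sum_range_succ'] at h1
      have h2 : ∀ j : ℕ, ((N + 1 : ℕ) : ℤ) - 1 - j = N - j := fun j => by push_cast; ring
      have h3 : ∀ j : ℕ, (N : ℤ) - ((j + 1 : ℕ) : ℤ) = N - 1 - j := fun j => by push_cast; ring
      simp only [h2, h3, Nat.cast_zero, sub_zero] at h1 ⊢
      linarith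
  rw [key]
  calc _ ≤ ∑ j ∈ Finset.range b, |F (N - 1 - j) - F (-1 - j)| := Finset.abs_sum_le_sum_abs _ _
    _ ≤ ∑ _j ∈ Finset.range b, (2 : ℝ) := Finset.sum_le_sum fun j _ => by
        have h1 := hF (N - 1 - j)
        have h2 := hF (-1 - j)
        rw [abs_le] at *
        constructor <;> linarith
    _ = 2 * b := by simp [mul_comm]

theorem stmt_2 (a : ℕ → ℕ) (ha : ∀ i, 0 < a i) (k : ℕ) (hk : 2 ≤ k) :
    ∃ d : ℝ,
      Tendsto (fun N : ℕ =>
          (((Finset.range (N + 1)).filter (fun n : ℕ =>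
            pA a k (n : ℤ) % 2 = 1 ∧ pA a (k - 1) (n : ℤ) % 2 = 1)).card : ℝ) / N)
        atTop (nhds d) ∧
      Tendsto (fun N : ℕ =>
          (((Finset.range (N + 1)).filter (fun n : ℕ =>
            pA a k (n : ℤ) % 2 = 0 ∧ pA a (k - 1) (n : ℤ) % 2 = 1)).card : ℝ) / N)
        atTop (nhds d) := by
  obtain ⟨k, rfl⟩ : ∃ m, k = m + 1 := ⟨k - 1, by omega⟩
  rw [Nat.add_sub_cancel]
  obtain ⟨T, hT, hper⟩ := pA_mod_two_periodic a ha (k + 1)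
  obtain ⟨S, hS, hper'⟩ := pA_mod_two_periodic a ha k
  obtain ⟨d, B, hd⟩ := exists_density_of_periodic
    (fun n : ℕ => pA a (k + 1) (n : ℤ) % 2 = 1 ∧ pA a k (n : ℤ) % 2 = 1) (S * T)
    (by positivity) (fun n hn => by
      have h1 := mod_two_add_mul_of_periodic _ T hper S n (by exact_mod_cast hn)
      have h2 := mod_two_add_mul_of_periodic _ S hper' T n (by exact_mod_cast hn)
      rw [mul_comm (T : ℤ)] at h2
      push_cast
      rw [h1, h2])
  refine ⟨d, tendsto_div_atTop_of_abs_sub_le _ d B hd,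
    tendsto_div_atTop_of_abs_sub_le _ d (B + 2 * a (k + 1)) fun N => ?_⟩
  have hshift := abs_sum_sub_shift_le (fun n => ((pA a (k + 1) n % 2 : ℕ) : ℝ)) (fun n => by
    have h : pA a (k + 1) n % 2 ≤ 1 := by omega
    rw [Nat.abs_cast]
    exact_mod_cast h) (a (k + 1)) (N + 1)
  have heq : ∑ n ∈ Finset.range (N + 1), (((pA a (k + 1) n % 2 : ℕ) : ℝ) -
      ((pA a (k + 1) (n - a (k + 1)) % 2 : ℕ) : ℝ)) =
      (((Finset.range (N + 1)).filter (fun n : ℕ =>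
        pA a (k + 1) (n : ℤ) % 2 = 1 ∧ pA a k (n : ℤ) % 2 = 1)).card : ℝ) -
      (((Finset.range (N + 1)).filter (fun n : ℕ =>
        pA a (k + 1) (n : ℤ) % 2 = 0 ∧ pA a k (n : ℤ) % 2 = 1)).card : ℝ) := by
    rw [Finset.natCast_card_filter, Finset.natCast_card_filter, ← Finset.sum_sub_distrib]
    refine Finset.sum_congr rfl fun n _ => ?_
    have h := pA_succ a ha k n
    rcases Nat.mod_two_eq_zero_or_one (pA a (k + 1) (n - a (k + 1))) with h1 | h1 <;>
    rcases Nat.mod_two_eq_zero_or_one (pA a k n) with h2 | h2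
    · have h3 : pA a (k + 1) n % 2 = 0 := by omega
      simp [h1, h2, h3]
    · have h3 : pA a (k + 1) n % 2 = 1 := by omega
      simp [h1, h2, h3]
    · have h3 : pA a (k + 1) n % 2 = 1 := by omega
      simp [h1, h2, h3]
    · have h3 : pA a (k + 1) n % 2 = 0 := by omega
      simp [h1, h2, h3]
  rw [heq] at hshift
  have hdN := hd N
  rw [abs_le] at *
  constructor <;> linarith
end

section
/- Let 𝒜 = (a_i)_{i≥1} be a sequence of positive integers, and let k ≥ 1 and m ≥ 2 be integers. Then the lower asymptotic density of the set {n ∈ ℕ : p_𝒜(n,k) ≢ 0 (mod m)} is at least 1/(a_1 + ⋯ + a_k); i.e. liminf_{N→∞} #{n ≤ N : p_𝒜(n,k) ≢ 0 (mod m)}/N ≥ 1/(a_1 + ⋯ + a_k). -/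
open Filter

lemma finite_pA_solutions (a : ℕ → ℕ) (ha : ∀ i, 0 < a i) (k : ℕ) (n : ℤ) :
    {x : Fin k → ℕ | ∑ i : Fin k, (x i : ℤ) * (a (i.val + 1) : ℤ) = n}.Finite := by
  refine (Set.finite_Iic (fun _ : Fin k => n.toNat)).subset fun x hx i => ?_
  have h1 : (x i : ℤ) * (a (i.val + 1) : ℤ) ≤ n := by
    rw [← (show _ = n from hx)]
    exact Finset.single_le_sum (f := fun i : Fin k => (x i : ℤ) * (a (i.val + 1) : ℤ))
      (fun j _ => by positivity) (Finset.mem_univ i)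
  have h2 : (1 : ℤ) ≤ a (i.val + 1) := by exact_mod_cast ha _
  have h3 : (x i : ℤ) ≤ n := by nlinarith [Int.natCast_nonneg (x i)]
  change x i ≤ n.toNat
  omega

lemma pA_one_mul (a : ℕ → ℕ) (ha : ∀ i, 0 < a i) (q : ℕ) :
    pA a 1 ((a 1 * q : ℕ) : ℤ) = 1 := by
  rw [pA, Nat.card_eq_one_iff_unique]
  refine ⟨⟨fun x y => ?_⟩, ⟨⟨fun _ => q, by simp [mul_comm]⟩⟩⟩
  have h : (x.1 0 : ℤ) * a 1 = (y.1 0 : ℤ) * a 1 := by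
    simpa using x.2.trans y.2.symm
  have h1 : (a 1 : ℤ) ≠ 0 := by exact_mod_cast (ha 1).ne'
  ext i
  rw [Subsingleton.elim i 0]
  exact_mod_cast mul_right_cancel₀ h1 h

/-- Among any `a 1 + ⋯ + a k` consecutive integers there is one at which `pA a k` is not
divisible by `m`. -/
lemma exists_not_dvd_pA (a : ℕ → ℕ) (ha : ∀ i, 0 < a i) (m : ℕ) (hm : 2 ≤ m) (k : ℕ)
    (hk : 1 ≤ k) : ∀ s : ℕ, ∃ n : ℕ, s ≤ n ∧ n < s + ∑ j ∈ Finset.Icc 1 k, a j ∧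
      ¬ m ∣ pA a k (n : ℤ) := by
  induction k, hk using Nat.le_induction with
  | base =>
    intro s
    have h1 := Nat.div_add_mod (s + a 1 - 1) (a 1)
    have h2 := Nat.mod_lt (s + a 1 - 1) (ha 1)
    have h3 := ha 1
    refine ⟨a 1 * ((s + a 1 - 1) / a 1), by omega, by simp; omega, ?_⟩
    rw [pA_one_mul a ha, Nat.dvd_one]
    omega
  | succ k hk ih =>
    intro s
    obtain ⟨n, hn1, hn2, hn⟩ := ih (s + a (k + 1))
    rw [Finset.sum_Icc_succ_top (by omega)]
    by_cases h : m ∣ pA a (k + 1) (n : ℤ)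
    · refine ⟨n - a (k + 1), by omega, by omega, fun h' => hn ?_⟩
      rw [Nat.cast_sub (by omega)] at h'
      rw [pA_succ a ha] at h
      exact (Nat.dvd_add_right h').1 h
    · exact ⟨n, by omega, by omega, h⟩

/-- A set meeting every window of length `S` has lower density at least `1 / S`. -/
lemma one_div_le_liminf_of_forall_window (p : ℕ → Prop) [DecidablePred p] (S : ℕ) (hS : 0 < S)
    (h : ∀ s, ∃ n, s ≤ n ∧ n < s + S ∧ p n) :
    (1 : ℝ) / S ≤ liminf (fun N : ℕ =>
      (((Finset.range (N + 1)).filter p).card : ℝ) / N) atTop := by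
  choose g hg1 hg2 hg3 using h
  have hcard (N : ℕ) : (N + 1) / S ≤ ((Finset.range (N + 1)).filter p).card := by
    conv_lhs => rw [← Finset.card_range ((N + 1) / S)]
    refine Finset.card_le_card_of_injOn (fun j => g (S * j)) (fun j hj => ?_)
      fun i _ j _ hij => ?_
    · have hj' : j + 1 ≤ (N + 1) / S := by simpa using hj
      have h1 := Nat.mul_le_mul_left S hj'
      have h2 := Nat.mul_div_le (N + 1) S
      have h3 := hg2 (S * j)
      simp only [Finset.coe_filter, Finset.mem_range, Set.mem_ofPred_eq]
      exact ⟨by rw [mul_add] at h1; omega, hg3 _⟩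
    · have key (j : ℕ) : g (S * j) / S = j :=
        Nat.div_eq_of_lt_le (by rw [mul_comm]; exact hg1 _)
          (by rw [add_mul, one_mul, mul_comm]; exact hg2 _)
      rw [← key i, ← key j]
      exact congrArg (· / S) hij
  have hlim : Tendsto (fun N : ℕ => (1 : ℝ) / S - 1 / N) atTop (nhds (1 / S)) := by
    simpa using (tendsto_const_nhds (x := (1 : ℝ) / S)).sub
      (tendsto_one_div_atTop_nhds_zero_nat (𝕜 := ℝ))
  rw [← hlim.liminf_eq]
  refine liminf_le_liminf ?_ hlim.isBoundedUnder_ge ?_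
  · filter_upwards [eventually_ge_atTop 1] with N hN
    have hN' : (0 : ℝ) < N := by exact_mod_cast hN
    have hS' : (0 : ℝ) < S := by exact_mod_cast hS
    have h1 : (N : ℝ) ≤ S * (((Finset.range (N + 1)).filter p).card + 1) := by
      have := Nat.lt_mul_div_succ (N + 1) hS
      have := Nat.mul_le_mul_left S (Nat.succ_le_succ (hcard N))
      exact_mod_cast (by simp only [Nat.succ_eq_add_one] at *; omega :
        N ≤ S * (((Finset.range (N + 1)).filter p).card + 1))
    rw [le_div_iff₀ hN', sub_mul, one_div_mul_cancel hN'.ne', sub_le_iff_le_add,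
      one_div_mul_eq_div, div_le_iff₀' hS']
    exact h1
  · refine IsBoundedUnder.isCoboundedUnder_ge ⟨2, ?_⟩
    rw [eventually_map]
    filter_upwards [eventually_ge_atTop 1] with N hN
    have hN' : (1 : ℝ) ≤ N := by exact_mod_cast hN
    have h1 : (((Finset.range (N + 1)).filter p).card : ℝ) ≤ N + 1 := by
      exact_mod_cast (Finset.card_filter_le _ _).trans (Finset.card_range _).le
    rw [div_le_iff₀ (by linarith)]
    linarith

/-- The lower asymptotic density of `{n : p_𝒜(n,k) ≢ 0 (mod m)}` is at least
`1 / (a 1 + ⋯ + a k)`. -/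
theorem stmt_5 (a : ℕ → ℕ) (ha : ∀ i, 0 < a i) (k m : ℕ) (hk : 1 ≤ k) (hm : 2 ≤ m) :
    (1 : ℝ) / (∑ j ∈ Finset.Icc 1 k, a j : ℕ) ≤
      liminf (fun N : ℕ =>
        (((Finset.range (N + 1)).filter (fun n : ℕ =>
          ¬ (m ∣ pA a k (n : ℤ)))).card : ℝ) / N) atTop := by
  exact one_div_le_liminf_of_forall_window _ _
    (Finset.sum_pos (fun j _ => ha j) (Finset.nonempty_Icc.2 hk))
    (exists_not_dvd_pA a ha m hm k hk)
end

section
/- Fix an integer m ≥ 2 and let ℳ = (m^{i−1})_{i≥1}. For every integer k ≥ 1 and every n ∈ ℕ, if c_j = ⌊n/m^j⌋ mod m denotes the j-th digit of n in base m, then p_ℳ(n,k) ≡ (c_1 + 1)(c_2 + 1)⋯(c_{k−1} + 1) (mod m), where the empty product (for k = 1) equals 1. -/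
/-- `pM m k n` is the number of restricted `m`-ary partitions of `n` with parts
`1, m, m^2, …, m^(k-1)`, i.e. the number of `k`-tuples `(x 1, …, x k)` of
nonnegative integers with `x 1 * m^0 + ⋯ + x k * m^(k-1) = n`. -/
noncomputable def pM (m k n : ℕ) : ℕ :=
  Nat.card {x : Fin k → ℕ // ∑ i : Fin k, x i * m ^ (i : ℕ) = n}

/-- A restricted `m`-ary partition of `n` into `k + 1` parts amounts to a partition into `k` parts
of some `q ≤ n / m`, namely of the value of its parts divisible by `m`, divided by `m`. -/
def restrictedPartitionSuccEquiv (m k n : ℕ) (hm : 0 < m) :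
    {x : Fin (k + 1) → ℕ // ∑ i, x i * m ^ (i : ℕ) = n} ≃
      Σ q : Fin (n / m + 1), {x : Fin k → ℕ // ∑ i, x i * m ^ (i : ℕ) = q} where
  toFun x := ⟨⟨∑ i : Fin k, x.1 i.succ * m ^ (i : ℕ), by
      have h := x.2
      simp only [Fin.sum_univ_succ, Fin.val_zero, Fin.val_succ, pow_zero, mul_one, pow_succ,
        ← mul_assoc, ← Finset.sum_mul] at h
      rw [Nat.lt_succ_iff, Nat.le_div_iff_mul_le hm]
      omega⟩, ⟨fun i => x.1 i.succ, rfl⟩⟩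
  invFun y := ⟨Fin.cons (n - y.1 * m) y.2.1, by
      have h := (Nat.le_div_iff_mul_le hm).1 (Nat.lt_succ_iff.1 y.1.2)
      simp only [Fin.sum_univ_succ, Fin.val_zero, Fin.val_succ, pow_zero, mul_one, pow_succ,
        ← mul_assoc, ← Finset.sum_mul, Fin.cons_zero, Fin.cons_succ, y.2.2]
      omega⟩
  left_inv x := by
    have h := x.2
    simp only [Fin.sum_univ_succ, Fin.val_zero, Fin.val_succ, pow_zero, mul_one, pow_succ,
      ← mul_assoc, ← Finset.sum_mul] at h
    ext i
    refine Fin.cases ?_ (fun i => ?_) i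
    · simp only [Fin.cons_zero]
      omega
    · simp
  right_inv := by
    rintro ⟨⟨q, hq⟩, x, hx⟩
    dsimp only at hx
    subst hx
    rfl

theorem finite_restrictedPartition (m : ℕ) (hm : 0 < m) (k n : ℕ) :
    Finite {x : Fin k → ℕ // ∑ i, x i * m ^ (i : ℕ) = n} := by
  induction k generalizing n with
  | zero => infer_instance
  | succ k ih => exact Finite.of_equiv _ (restrictedPartitionSuccEquiv m k n hm).symm

theorem pM_succ (m : ℕ) (hm : 0 < m) (k n : ℕ) :
    pM m (k + 1) n = ∑ q ∈ Finset.range (n / m + 1), pM m k q := by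
  have := finite_restrictedPartition m hm k
  rw [pM, Nat.card_congr (restrictedPartitionSuccEquiv m k n hm), Nat.card_sigma,
    Finset.sum_range]
  rfl

theorem pM_one (m n : ℕ) : pM m 1 n = 1 := by
  rw [pM, Nat.card_eq_one_iff_unique]
  refine ⟨⟨fun x y => ?_⟩, ⟨⟨fun _ => n, by simp⟩⟩⟩
  have hx := x.2
  have hy := y.2
  simp only [Fin.sum_univ_one, Fin.val_zero, pow_zero, mul_one] at hx hy
  ext i
  rw [Subsingleton.elim i 0, hx, hy]

theorem sum_range_mul_div_modEq_zero (m : ℕ) (hm : 0 < m) (g : ℕ → ℕ) (a : ℕ) :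
    ∑ q ∈ Finset.range (m * a), g (q / m) ≡ 0 [MOD m] := by
  induction a with
  | zero => simp [Nat.ModEq.refl]
  | succ a ih =>
    have h : ∑ i ∈ Finset.range m, g ((m * a + i) / m) = m * g a := by
      rw [Finset.sum_congr rfl (g := fun _ => g a)]
      · simp
      · intro i hi
        rw [Nat.mul_add_div hm, Nat.div_eq_of_lt (Finset.mem_range.1 hi), add_zero]
    rw [Nat.mul_succ, Finset.sum_range_add, h]
    simpa using ih.add ((Nat.modEq_zero_iff_dvd).2 (dvd_mul_right m (g a)))

theorem sum_range_succ_div_modEq (m : ℕ) (hm : 0 < m) (g : ℕ → ℕ) (N : ℕ) :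
    ∑ q ∈ Finset.range (N + 1), g (q / m) ≡ (N % m + 1) * g (N / m) [MOD m] := by
  have h : ∑ i ∈ Finset.range (N % m + 1), g ((m * (N / m) + i) / m) =
      (N % m + 1) * g (N / m) := by
    rw [Finset.sum_congr rfl (g := fun _ => g (N / m))]
    · simp
    · intro i hi
      have := Nat.mod_lt N hm
      have := Finset.mem_range.1 hi
      rw [Nat.mul_add_div hm, Nat.div_eq_of_lt (a := i) (by omega), add_zero]
  have hN : N + 1 = m * (N / m) + (N % m + 1) := by
    rw [← add_assoc, Nat.div_add_mod]
  rw [hN, Finset.sum_range_add, h]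
  simpa using (sum_range_mul_div_modEq_zero m hm g (N / m)).add_right ((N % m + 1) * g (N / m))

theorem pM_succ_modEq (m : ℕ) (hm : 0 < m) (k n : ℕ) :
    pM m (k + 1) n ≡ ∏ j ∈ Finset.range k, (n / m / m ^ j % m + 1) [MOD m] := by
  induction k generalizing n with
  | zero => simp [pM_one, Nat.ModEq.refl]
  | succ k ih =>
    rw [pM_succ m hm, Finset.prod_range_succ']
    refine (Nat.ModEq.sum fun q _ => ih q).trans ?_
    refine (sum_range_succ_div_modEq m hm
      (fun r => ∏ j ∈ Finset.range k, (r / m ^ j % m + 1)) (n / m)).trans ?_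
    simp only [pow_succ', ← Nat.div_div_eq_div_mul, pow_zero, Nat.div_one]
    rw [mul_comm]

/-- `p_ℳ(n,k) ≡ (c₁+1)(c₂+1)⋯(c_{k-1}+1) (mod m)` where `c_j` is the `j`-th
base-`m` digit of `n`. -/
theorem stmt_6 (m : ℕ) (hm : 2 ≤ m) (k : ℕ) (hk : 1 ≤ k) (n : ℕ) :
    pM m k n ≡ ∏ j ∈ Finset.Icc 1 (k - 1), (n / m ^ j % m + 1) [MOD m] := by
  obtain ⟨k, rfl⟩ := Nat.exists_eq_add_of_le' hk
  convert pM_succ_modEq m (by omega) k n using 1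
  rw [Nat.add_sub_cancel, Finset.range_eq_Ico, ← Finset.Ico_add_one_right_eq_Icc,
    ← Finset.prod_Ico_add' _ 0 k 1]
  simp only [pow_succ', Nat.div_div_eq_div_mul]
end

section
/- Let m = 2 and ℳ = (2^{i−1})_{i≥1}. For all integers k ≥ 1 and n ≥ 0, the following are equivalent: (1) p_ℳ(n,k) is odd; (2) every base-2 digit c_j = ⌊n/2^j⌋ mod 2 with 1 ≤ j ≤ k−1 equals 0; (3) n ≡ 0 or 1 (mod 2^k). -/
theorem finite_setOf_sum_mul_pow_eq {m : ℕ} (hm : 0 < m) (k n : ℕ) :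
    {x : Fin k → ℕ | ∑ i : Fin k, x i * m ^ (i : ℕ) = n}.Finite := by
  refine (Set.finite_Iic (fun _ : Fin k => n)).subset fun x hx i => ?_
  calc x i ≤ x i * m ^ (i : ℕ) := Nat.le_mul_of_pos_right _ (pow_pos hm _)
    _ ≤ ∑ i : Fin k, x i * m ^ (i : ℕ) :=
      Finset.single_le_sum (f := fun i : Fin k => x i * m ^ (i : ℕ))
        (fun _ _ => Nat.zero_le _) (Finset.mem_univ i)
    _ = n := hx

theorem pM_eq_ncard (m k n : ℕ) :
    pM m k n = {x : Fin k → ℕ | ∑ i : Fin k, x i * m ^ (i : ℕ) = n}.ncard := rfl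

theorem pM_succ_of_lt {m k n : ℕ} (h : n < m ^ k) : pM m (k + 1) n = pM m k n := by
  rw [pM_eq_ncard, pM_eq_ncard, ← Set.ncard_image_of_injective {x : Fin k → ℕ | _}
    (Fin.snoc_left_injective (α := fun _ => ℕ) (0 : ℕ))]
  congr 1
  ext x
  simp only [Set.mem_ofPred_eq, Set.mem_image, Fin.sum_univ_castSucc, Fin.val_castSucc,
    Fin.val_last]
  constructor
  · intro hx
    have h0 : x (Fin.last k) = 0 := by
      by_contra h0
      have := Nat.le_mul_of_pos_left (m ^ k) (Nat.pos_of_ne_zero h0)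
      omega
    refine ⟨Fin.init x, by simpa [h0, Fin.init] using hx, ?_⟩
    rw [← h0, Fin.snoc_init_self]
  · rintro ⟨y, hy, rfl⟩
    simpa using hy

theorem pM_succ_add {m : ℕ} (hm : 0 < m) (k n : ℕ) :
    pM m (k + 1) (n + m ^ k) = pM m k (n + m ^ k) + pM m (k + 1) n := by
  have hinj : Function.Injective
      (fun x : Fin (k + 1) → ℕ => x + Pi.single (Fin.last k) 1) := add_left_injective _
  simp only [pM_eq_ncard]
  rw [← Set.ncard_image_of_injective {x : Fin k → ℕ | _}
    (Fin.snoc_left_injective (α := fun _ => ℕ) (0 : ℕ)),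
    ← Set.ncard_image_of_injective {x : Fin (k + 1) → ℕ | ∑ i, x i * m ^ (i : ℕ) = n} hinj,
    ← Set.ncard_union_eq _ ((finite_setOf_sum_mul_pow_eq hm _ _).image _)
      ((finite_setOf_sum_mul_pow_eq hm _ _).image _)]
  · congr 1
    ext x
    simp only [Set.mem_ofPred_eq, Set.mem_image, Set.mem_union, Fin.sum_univ_castSucc,
      Fin.val_castSucc, Fin.val_last]
    constructor
    · intro hx
      rcases Nat.eq_zero_or_pos (x (Fin.last k)) with h0 | h0
      · refine Or.inl ⟨Fin.init x, by simpa [h0, Fin.init] using hx, ?_⟩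
        rw [← h0, Fin.snoc_init_self]
      · have hle : Pi.single (Fin.last k) 1 ≤ x := by
          intro i
          rcases eq_or_ne i (Fin.last k) with rfl | hi
          · simpa using Nat.succ_le_of_lt h0
          · simp [hi]
        refine Or.inr ⟨x - Pi.single (Fin.last k) 1, ?_, tsub_add_cancel_of_le hle⟩
        obtain ⟨c, hc⟩ := Nat.exists_eq_add_of_le' h0
        simp [hc, (Fin.castSucc_lt_last _).ne] at hx ⊢
        linarith
    · rintro (⟨y, hy, rfl⟩ | ⟨y, hy, rfl⟩)
      · simpa using hy
      · simp [(Fin.castSucc_lt_last _).ne]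
        linarith
  · rw [Set.disjoint_left]
    rintro _ ⟨y, -, rfl⟩ ⟨z, -, hz⟩
    simpa using congrFun hz (Fin.last k)

theorem odd_pM_two_iff (k : ℕ) (hk : 1 ≤ k) (n : ℕ) :
    Odd (pM 2 k n) ↔ n % 2 ^ k = 0 ∨ n % 2 ^ k = 1 := by
  induction k, hk using Nat.le_induction generalizing n with
  | base => simpa [pM_one] using Nat.mod_two_eq_zero_or_one n
  | succ k hk ih =>
    have h2 : 2 ≤ 2 ^ k := Nat.le_self_pow (by omega) 2
    induction n using Nat.strong_induction_on with
    | _ n ihn =>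
      rcases lt_or_ge n (2 ^ k) with h | h
      · rw [pM_succ_of_lt h, ih, Nat.mod_eq_of_lt h, Nat.mod_eq_of_lt (by rw [pow_succ]; omega)]
      · obtain ⟨r, rfl⟩ := Nat.exists_eq_add_of_le' h
        have hr' : Odd (pM 2 (k + 1) r) ↔ r % 2 ^ (k + 1) = 0 ∨ r % 2 ^ (k + 1) = 1 :=
          ihn r (by omega)
        rw [pM_succ_add two_pos, Nat.odd_add, ih, ← Nat.not_odd_iff_even, hr',
          Nat.mod_pow_succ, Nat.mod_pow_succ, Nat.add_mod_right,
          Nat.add_div_right _ (by positivity)]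
        have hr := Nat.mod_lt r (show 0 < 2 ^ k by positivity)
        rcases Nat.mod_two_eq_zero_or_one (r / 2 ^ k) with h0 | h0
        · have h1 : (r / 2 ^ k).succ % 2 = 1 := by omega
          rw [h0, h1]
          omega
        · have h1 : (r / 2 ^ k).succ % 2 = 0 := by omega
          rw [h0, h1]
          omega

theorem forall_div_two_pow_mod_two_eq_zero_iff (k : ℕ) (hk : 1 ≤ k) (n : ℕ) :
    (∀ j, 1 ≤ j → j ≤ k - 1 → n / 2 ^ j % 2 = 0) ↔ n % 2 ^ k = 0 ∨ n % 2 ^ k = 1 := by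
  induction k, hk using Nat.le_induction with
  | base =>
    rw [pow_one]
    exact iff_of_true (fun j _ _ => by omega) (Nat.mod_two_eq_zero_or_one n)
  | succ k hk ih =>
    have h2 : 2 ≤ 2 ^ k := Nat.le_self_pow (by omega) 2
    have hsplit : (∀ j, 1 ≤ j → j ≤ k + 1 - 1 → n / 2 ^ j % 2 = 0) ↔
        (∀ j, 1 ≤ j → j ≤ k - 1 → n / 2 ^ j % 2 = 0) ∧ n / 2 ^ k % 2 = 0 := by
      refine ⟨fun h => ⟨fun j h1 _ => h j h1 (by omega), h k hk (by omega)⟩, fun h j h1 _ => ?_⟩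
      rcases eq_or_ne j k with rfl | hj
      · exact h.2
      · exact h.1 j h1 (by omega)
    rw [hsplit, ih, Nat.mod_pow_succ]
    rcases Nat.mod_two_eq_zero_or_one (n / 2 ^ k) with h0 | h0 <;> rw [h0] <;> omega

theorem stmt_9 (k : ℕ) (hk : 1 ≤ k) (n : ℕ) :
    (Odd (pM 2 k n) ↔ ∀ j, 1 ≤ j → j ≤ k - 1 → n / 2 ^ j % 2 = 0) ∧
    ((∀ j, 1 ≤ j → j ≤ k - 1 → n / 2 ^ j % 2 = 0) ↔
      (n % 2 ^ k = 0 ∨ n % 2 ^ k = 1)) := by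
  exact ⟨(odd_pM_two_iff k hk n).trans (forall_div_two_pow_mod_two_eq_zero_iff k hk n).symm,
    forall_div_two_pow_mod_two_eq_zero_iff k hk n⟩
end
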